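/- arXiv:math/0701667 — 3 statements merged into one kernel-verified Lean document; each statement's English description precedes it below -/
import Mathlib

section
/- For all positive integers n and k with n > k, there exist polynomials f_1, ..., f_n in n real variables such that the union of the supports of f_1, ..., f_n consists of exactly n+k+1 distinct exponent vectors (monomials), and there exist at least ⌊(n+k)/k⌋^k distinct points x in the positive orthant ℝ^n_> with f_1(x) = ... = f_n(x) = 0 and each such point is a nondegenerate solution. -/
open Polynomial in
/-- The pair `(U, V)` obtained from `(1, X)` by iterating
`(U, V) ↦ (V, U * (1 + c i * X) ^ 2)`. -/
noncomputable def alternatingPair (c : ℕ → ℝ) : ℕ → ℝ[X] × ℝ[X]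
  | 0 => (1, X)
  | n + 1 => ((alternatingPair c n).2, (alternatingPair c n).1 * (1 + C (c n) * X) ^ 2)

/-- The difference of the two members of `alternatingPair c n`. -/
noncomputable def eliminant (c : ℕ → ℝ) (n : ℕ) : Polynomial ℝ :=
  (alternatingPair c n).2 - (alternatingPair c n).1

theorem alternatingPair_congr {c d : ℕ → ℝ} {n : ℕ} (h : ∀ i < n, c i = d i) :
    alternatingPair c n = alternatingPair d n := by
  induction n with
  | zero => rfl
  | succ n ih =>
    simp only [alternatingPair, ih fun i hi => h i (by omega), h n (by omega)]

section Polynomial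

open Polynomial

theorem natDegree_linearFactor {a : ℝ} (ha : 0 < a) : (1 + C a * X : ℝ[X]).natDegree = 1 := by
  rw [add_comm, ← C_1]
  exact natDegree_linear ha.ne'

theorem leadingCoeff_linearFactor {a : ℝ} (ha : 0 < a) :
    (1 + C a * X : ℝ[X]).leadingCoeff = a := by
  rw [add_comm, ← C_1]
  exact leadingCoeff_linear ha.ne'

theorem alternatingPair_degree {c : ℕ → ℝ} (hc : ∀ i, 0 < c i) (n : ℕ) :
    (alternatingPair c n).1.natDegree = n ∧ 0 < (alternatingPair c n).1.leadingCoeff ∧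
    (alternatingPair c n).2.natDegree = n + 1 ∧ 0 < (alternatingPair c n).2.leadingCoeff := by
  induction n with
  | zero => simp [alternatingPair]
  | succ n ih =>
    obtain ⟨h1, h2, h3, h4⟩ := ih
    have hl := leadingCoeff_linearFactor (hc n)
    have hne : (1 + C (c n) * X : ℝ[X]) ≠ 0 := by
      rw [← leadingCoeff_ne_zero, hl]
      exact (hc n).ne'
    refine ⟨h3, h4, ?_, ?_⟩
    · rw [alternatingPair, natDegree_mul (leadingCoeff_ne_zero.1 h2.ne') (pow_ne_zero 2 hne),
        natDegree_pow, h1, natDegree_linearFactor (hc n)]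
    · rw [alternatingPair, leadingCoeff_mul, leadingCoeff_pow, hl]
      exact mul_pos h2 (pow_pos (hc n) 2)

theorem alternatingPair_eval_pos {c : ℕ → ℝ} (hc : ∀ i, 0 < c i) {t : ℝ} (ht : 0 < t) (n : ℕ) :
    0 < (alternatingPair c n).1.eval t ∧ 0 < (alternatingPair c n).2.eval t := by
  induction n with
  | zero => simpa [alternatingPair] using ht
  | succ n ih =>
    refine ⟨ih.2, ?_⟩
    have := hc n
    simp only [alternatingPair, eval_mul, eval_pow, eval_add, eval_one, eval_C, eval_X]
    have := ih.1
    positivity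

theorem eliminant_degree {c : ℕ → ℝ} (hc : ∀ i, 0 < c i) (n : ℕ) :
    (eliminant c n).natDegree = n + 1 ∧ 0 < (eliminant c n).leadingCoeff := by
  obtain ⟨h1, h2, h3, h4⟩ := alternatingPair_degree hc n
  have hlt : (alternatingPair c n).1.natDegree < (alternatingPair c n).2.natDegree := by omega
  refine ⟨by rw [eliminant, natDegree_sub_eq_left_of_natDegree_lt hlt, h3], ?_⟩
  rwa [eliminant, leadingCoeff_sub_of_degree_lt (degree_lt_degree hlt)]

theorem eventually_eliminant_pos {c : ℕ → ℝ} (hc : ∀ i, 0 < c i) (n : ℕ) :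
    ∀ᶠ t in Filter.atTop, 0 < (eliminant c n).eval t := by
  obtain ⟨h1, h2⟩ := eliminant_degree hc n
  refine (tendsto_atTop_of_leadingCoeff_nonneg _ ?_ h2.le).eventually_gt_atTop 0
  exact natDegree_pos_iff_degree_pos.1 (by omega)

/-- For suitable positive parameters the eliminant alternates in sign at `n + 2` positive
points, listed in decreasing order. -/
theorem exists_eliminant_alternating (n : ℕ) :
    ∃ c : ℕ → ℝ, (∀ i, 0 < c i) ∧ ∃ q : ℕ → ℝ, (∀ j ≤ n + 1, 0 < q j) ∧
      (∀ j ≤ n, q (j + 1) < q j) ∧ ∀ j ≤ n + 1, 0 < (-1) ^ j * (eliminant c n).eval (q j) := by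
  induction n with
  | zero =>
    refine ⟨fun _ => 1, fun _ => one_pos, fun j => if j = 0 then 2 else 1 / 2, ?_, ?_, ?_⟩
    · intro j _
      dsimp only
      split_ifs <;> norm_num
    · intro j hj
      obtain rfl : j = 0 := by omega
      norm_num
    · intro j hj
      obtain rfl | rfl : j = 0 ∨ j = 1 := by omega
      all_goals norm_num [eliminant, alternatingPair]
  | succ n ih =>
    obtain ⟨c, hc, q, hq, hdec, hsign⟩ := ih
    have hup (a : ℝ) : alternatingPair (Function.update c n a) n = alternatingPair c n :=
      alternatingPair_congr fun i hi => Function.update_of_ne hi.ne _ _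
    have hev (a t : ℝ) : (eliminant (Function.update c n a) (n + 1)).eval t =
        (alternatingPair c n).1.eval t * (1 + a * t) ^ 2 - (alternatingPair c n).2.eval t := by
      simp [eliminant, alternatingPair, hup]
    have hsmall : ∀ᶠ a in nhdsWithin (0 : ℝ) (Set.Ioi 0), ∀ j ∈ Finset.range (n + 2),
        0 < (-1) ^ (j + 1) * (eliminant (Function.update c n a) (n + 1)).eval (q j) := by
      rw [Filter.eventually_all_finset]
      intro j hj
      have hcont : Continuous fun a : ℝ =>
          (-1) ^ (j + 1) * (eliminant (Function.update c n a) (n + 1)).eval (q j) := by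
        simp only [hev]
        fun_prop
      refine nhdsWithin_le_nhds ((hcont.tendsto 0).eventually_const_lt ?_)
      have := hsign j (by have := Finset.mem_range.1 hj; omega)
      simp only [eliminant, eval_sub] at this
      rw [hev, pow_succ]
      linarith
    obtain ⟨a, ha, ha0⟩ := (hsmall.and self_mem_nhdsWithin).exists
    have hc' : ∀ i, 0 < Function.update c n a i := by
      intro i
      rcases eq_or_ne i n with rfl | h
      · simpa using ha0
      · simpa [Function.update_of_ne h] using hc i
    obtain ⟨b, hb, hbq⟩ := ((eventually_eliminant_pos hc' (n + 1)).and
      (Filter.eventually_gt_atTop (q 0))).exists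
    refine ⟨_, hc', fun j => Nat.casesOn j b q, ?_, ?_, ?_⟩
    · rintro (_ | j) hj
      · exact (hq 0 (by omega)).trans hbq
      · exact hq j (by omega)
    · rintro (_ | j) hj
      · exact hbq
      · exact hdec j (by omega)
    · rintro (_ | j) hj
      · simpa using hb
      · exact ha j (Finset.mem_range.2 (by omega))

theorem exists_root_of_mul_neg (p : ℝ[X]) {a b : ℝ} (hab : a < b)
    (h : p.eval a * p.eval b < 0) : ∃ r ∈ Set.Ioo a b, p.eval r = 0 := by
  have hcont : ContinuousOn (fun t => p.eval t) (Set.Icc a b) := p.continuous.continuousOn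
  rcases mul_neg_iff.1 h with ⟨h1, h2⟩ | ⟨h1, h2⟩
  · exact intermediate_value_Ioo' hab.le hcont ⟨h2, h1⟩
  · exact intermediate_value_Ioo hab.le hcont ⟨h1, h2⟩

/-- For suitable positive parameters the eliminant has `n + 1` simple positive roots. -/
theorem exists_eliminant_simple_roots (n : ℕ) :
    ∃ c : ℕ → ℝ, (∀ i, 0 < c i) ∧ ∃ R : Finset ℝ, R.card = n + 1 ∧
      ∀ t ∈ R, 0 < t ∧ (eliminant c n).eval t = 0 ∧ (eliminant c n).derivative.eval t ≠ 0 := by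
  obtain ⟨c, hc, q, hq, hdec, hsign⟩ := exists_eliminant_alternating n
  have hex (j : ℕ) : ∃ r, j ≤ n → r ∈ Set.Ioo (q (j + 1)) (q j) ∧ (eliminant c n).eval r = 0 := by
    by_cases hj : j ≤ n
    · obtain ⟨r, hr⟩ := exists_root_of_mul_neg (eliminant c n) (hdec j hj) (by
        have h := mul_pos (hsign j (by omega)) (hsign (j + 1) (by omega))
        have h2 : ((-1 : ℝ) ^ j) * (-1) ^ j = 1 := by
          rw [← mul_pow]
          simp
        rw [pow_succ] at h
        linear_combination h - (eliminant c n).eval (q j) * (eliminant c n).eval (q (j + 1)) * h2)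
      exact ⟨r, fun _ => hr⟩
    · exact ⟨0, fun h => absurd h hj⟩
  choose r hr using hex
  have hle : ∀ i j, i < j → j ≤ n → r j < r i := by
    intro i j hij
    induction j, hij using Nat.le_induction with
    | base => exact fun h => ((hr (i + 1) h).1.2).trans (hr i (by omega)).1.1
    | succ j hij ih =>
      exact fun h => (((hr (j + 1) h).1.2).trans (hr j (by omega)).1.1).trans (ih (by omega))
  have hinj : Set.InjOn r (Finset.range (n + 1)) := by
    intro i hi j hj hij
    simp only [Finset.coe_range, Set.mem_Iio] at hi hj
    by_contra hne
    rcases Nat.lt_or_gt_of_ne hne with h | h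
    · exact (hle i j h (by omega)).ne' hij
    · exact (hle j i h (by omega)).ne hij
  have hcard := Finset.card_image_of_injOn hinj
  rw [Finset.card_range] at hcard
  obtain ⟨hdeg, hlead⟩ := eliminant_degree hc n
  have hne : eliminant c n ≠ 0 := leadingCoeff_ne_zero.1 hlead.ne'
  have hsub : (Finset.range (n + 1)).image r ⊆ (eliminant c n).roots.toFinset := by
    intro t ht
    obtain ⟨j, hj, rfl⟩ := Finset.mem_image.1 ht
    rw [Multiset.mem_toFinset, mem_roots hne]
    exact (hr j (by have := Finset.mem_range.1 hj; omega)).2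
  have hnodup : (eliminant c n).roots.Nodup := by
    rw [← Multiset.toFinset_card_eq_card_iff_nodup]
    have h1 := Finset.card_le_card hsub
    have h2 := (eliminant c n).card_roots'
    have h3 := (eliminant c n).roots.toFinset_card_le
    omega
  refine ⟨c, hc, _, hcard, fun t ht => ?_⟩
  have hroot : (eliminant c n).IsRoot t := by
    rw [← mem_roots hne, ← Multiset.mem_toFinset]
    exact hsub ht
  refine ⟨?_, hroot, fun h => ?_⟩
  · obtain ⟨j, hj, rfl⟩ := Finset.mem_image.1 ht
    have := Finset.mem_range.1 hj
    exact (hq (j + 1) (by omega)).trans (hr j (by omega)).1.1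
  · have h1 := (one_lt_rootMultiplicity_iff_isRoot hne).2 ⟨hroot, h⟩
    have h2 := Multiset.nodup_iff_count_le_one.1 hnodup t
    rw [count_roots] at h2
    omega

/-- Along a sequence with `x j * x (j + 1) = 1 + c j * x 0 ^ 2`, the two members of
`alternatingPair` at `x 0 ^ 2` differ by the factor `x j ^ 2`. -/
theorem alternatingPair_eval_of_chain {c x : ℕ → ℝ} {n : ℕ}
    (h : ∀ j < n, x j * x (j + 1) = 1 + c j * x 0 ^ 2) :
    (alternatingPair c n).2.eval (x 0 ^ 2) =
      (alternatingPair c n).1.eval (x 0 ^ 2) * x n ^ 2 := by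
  induction n with
  | zero => simp [alternatingPair]
  | succ n ih =>
    simp only [alternatingPair, eval_mul, eval_pow, eval_add, eval_one, eval_C, eval_X]
    rw [← h n (by omega), ih fun j hj => h j (by omega)]
    ring

/-- The linearisation of `alternatingPair_eval_of_chain` along a tangent direction `v`. -/
theorem alternatingPair_derivative_of_chain {c x v : ℕ → ℝ} {n : ℕ}
    (h : ∀ j < n, x j * x (j + 1) = 1 + c j * x 0 ^ 2)
    (hv : ∀ j < n, v j * x (j + 1) + x j * v (j + 1) = c j * (2 * x 0 * v 0)) :
    (alternatingPair c n).2.derivative.eval (x 0 ^ 2) * (2 * x 0 * v 0) =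
      (alternatingPair c n).1.derivative.eval (x 0 ^ 2) * (2 * x 0 * v 0) * x n ^ 2 +
        (alternatingPair c n).1.eval (x 0 ^ 2) * (2 * x n * v n) := by
  induction n with
  | zero => simp [alternatingPair]
  | succ n ih =>
    have ih := ih (fun j hj => h j (by omega)) fun j hj => hv j (by omega)
    have hp := alternatingPair_eval_of_chain (n := n) fun j hj => h j (by omega)
    have hn := h n (by omega)
    have hvn := hv n (by omega)
    simp only [alternatingPair, derivative_mul, derivative_pow, derivative_add, derivative_one,
      derivative_C, derivative_X, eval_mul, eval_pow, eval_add, eval_one, eval_C, eval_X,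
      eval_zero]
    rw [← hn, hp]
    norm_num
    linear_combination (-x (n + 1) ^ 2) * ih -
      2 * (alternatingPair c n).1.eval (x 0 ^ 2) * x n * x (n + 1) * hvn

end Polynomial

section DirectionalDerivative

open MvPolynomial

variable {σ τ : Type} [Fintype σ] [Fintype τ]

/-- The derivative of the polynomial `p` at the point `x` in the direction `v`. -/
noncomputable def directionalDeriv (x v : σ → ℝ) (p : MvPolynomial σ ℝ) : ℝ :=
  ∑ j, eval x (pderiv j p) * v j

theorem directionalDeriv_add (x v : σ → ℝ) (p q : MvPolynomial σ ℝ) :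
    directionalDeriv x v (p + q) = directionalDeriv x v p + directionalDeriv x v q := by
  simp [directionalDeriv, add_mul, Finset.sum_add_distrib]

theorem directionalDeriv_sub (x v : σ → ℝ) (p q : MvPolynomial σ ℝ) :
    directionalDeriv x v (p - q) = directionalDeriv x v p - directionalDeriv x v q := by
  simp [directionalDeriv, sub_mul, Finset.sum_sub_distrib]

theorem directionalDeriv_mul (x v : σ → ℝ) (p q : MvPolynomial σ ℝ) :
    directionalDeriv x v (p * q) =
      directionalDeriv x v p * eval x q + eval x p * directionalDeriv x v q := by
  simp only [directionalDeriv, pderiv_mul, map_add, map_mul, Finset.sum_mul, Finset.mul_sum,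
    ← Finset.sum_add_distrib]
  exact Finset.sum_congr rfl fun j _ => by ring

theorem directionalDeriv_C (x v : σ → ℝ) (a : ℝ) : directionalDeriv x v (C a) = 0 := by
  simp [directionalDeriv]

theorem directionalDeriv_one (x v : σ → ℝ) : directionalDeriv x v 1 = 0 := by
  simp [directionalDeriv]

theorem directionalDeriv_X (x v : σ → ℝ) (i : σ) : directionalDeriv x v (X i) = v i := by
  classical
  simp [directionalDeriv, pderiv_X, Pi.single_apply, apply_ite (eval x)]

theorem directionalDeriv_rename (e : τ → σ) (x v : σ → ℝ) (p : MvPolynomial τ ℝ) :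
    directionalDeriv x v (rename e p) = directionalDeriv (x ∘ e) (v ∘ e) p := by
  induction p using MvPolynomial.induction_on with
  | C a => simp [directionalDeriv_C]
  | add p q hp hq => rw [map_add, directionalDeriv_add, directionalDeriv_add, hp, hq]
  | mul_X p i hp =>
    rw [map_mul, rename_X, directionalDeriv_mul, directionalDeriv_mul, hp, directionalDeriv_X,
      directionalDeriv_X, eval_X, eval_X, eval_rename, Function.comp_apply, Function.comp_apply]

/-- `x` is a nondegenerate zero of the system `f` all of whose coordinates are positive. -/
def IsNondegeneratePositiveZero {ι : Type} (f : ι → MvPolynomial σ ℝ) (x : σ → ℝ) : Prop :=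
  (∀ i, 0 < x i) ∧ (∀ i, eval x (f i) = 0) ∧
    ∀ v : σ → ℝ, (∀ i, directionalDeriv x v (f i) = 0) → v = 0

variable (σ) in
/-- There is a square system in the variables `σ` involving the monomial `1` and exactly `M`
other monomials, with at least `N` nondegenerate positive zeros. -/
def HasFewnomialSystem (M N : ℕ) : Prop :=
  ∃ f : σ → MvPolynomial σ ℝ,
    (∃ A : Finset (σ →₀ ℕ), (∀ m, m ∈ A ↔ ∃ i, m ∈ (f i).support) ∧ 0 ∈ A ∧ A.card = M + 1) ∧
    ∃ S : Finset (σ → ℝ), N ≤ S.card ∧ ∀ x ∈ S, IsNondegeneratePositiveZero f x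

theorem HasFewnomialSystem.mono {M N N' : ℕ} (h : HasFewnomialSystem σ M N) (hN : N' ≤ N) :
    HasFewnomialSystem σ M N' := by
  obtain ⟨f, hA, S, hS, hf⟩ := h
  exact ⟨f, hA, S, hN.trans hS, hf⟩

theorem HasFewnomialSystem.congr (e : σ ≃ τ) {M N : ℕ} (h : HasFewnomialSystem σ M N) :
    HasFewnomialSystem τ M N := by
  classical
  obtain ⟨f, ⟨A, hA, h0, hcard⟩, S, hS, hf⟩ := h
  have hsupp (i : τ) : (rename e (f (e.symm i))).support =
      (f (e.symm i)).support.image (Finsupp.mapDomain e) :=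
    support_rename_of_injective e.injective
  refine ⟨fun i => rename e (f (e.symm i)), ⟨A.image (Finsupp.mapDomain e), ?_, ?_, ?_⟩,
    S.map (e.arrowCongr (Equiv.refl ℝ)).toEmbedding, by simpa using hS, ?_⟩
  · intro m
    simp only [hsupp, Finset.mem_image, hA]
    constructor
    · rintro ⟨a, ⟨i, hi⟩, rfl⟩
      exact ⟨e i, a, by simpa using hi, rfl⟩
    · rintro ⟨i, a, ha, rfl⟩
      exact ⟨a, ⟨_, ha⟩, rfl⟩
  · exact Finset.mem_image.2 ⟨0, h0, Finsupp.mapDomain_zero⟩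
  · rw [Finset.card_image_of_injective _ (Finsupp.mapDomain_injective e.injective), hcard]
  · intro y hy
    obtain ⟨x, hx, rfl⟩ := Finset.mem_map.1 hy
    obtain ⟨hpos, hzero, hnd⟩ := hf x hx
    have hcomp : (e.arrowCongr (Equiv.refl ℝ)).toEmbedding x ∘ e = x := by
      ext i
      simp
    refine ⟨fun i => by simpa using hpos (e.symm i), fun i => ?_, fun v hv => ?_⟩
    · rw [eval_rename, hcomp, hzero]
    · have := hnd (v ∘ e) fun i => by
        have := hv (e i)
        rwa [directionalDeriv_rename, hcomp, e.symm_apply_apply] at this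
      ext i
      simpa using congrFun this (e.symm i)

theorem HasFewnomialSystem.sum {M₁ N₁ M₂ N₂ : ℕ} (h₁ : HasFewnomialSystem σ M₁ N₁)
    (h₂ : HasFewnomialSystem τ M₂ N₂) : HasFewnomialSystem (σ ⊕ τ) (M₁ + M₂) (N₁ * N₂) := by
  classical
  obtain ⟨f, ⟨A, hA, hA0, hAcard⟩, S, hS, hf⟩ := h₁
  obtain ⟨g, ⟨B, hB, hB0, hBcard⟩, T, hT, hg⟩ := h₂
  have hfsupp (i : σ) : (rename (Sum.inl : σ → σ ⊕ τ) (f i)).support =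
      (f i).support.image (Finsupp.mapDomain Sum.inl) :=
    support_rename_of_injective Sum.inl_injective
  have hgsupp (i : τ) : (rename (Sum.inr : τ → σ ⊕ τ) (g i)).support =
      (g i).support.image (Finsupp.mapDomain Sum.inr) :=
    support_rename_of_injective Sum.inr_injective
  refine ⟨Sum.elim (fun i => rename Sum.inl (f i)) (fun i => rename Sum.inr (g i)),
    ⟨A.image (Finsupp.mapDomain Sum.inl) ∪ B.image (Finsupp.mapDomain Sum.inr), ?_, ?_, ?_⟩,
    (S ×ˢ T).map (Equiv.sumArrowEquivProdArrow σ τ ℝ).symm.toEmbedding, ?_, ?_⟩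
  · intro m
    simp only [Finset.mem_union, Finset.mem_image, hA, hB, Sum.exists, Sum.elim_inl, Sum.elim_inr,
      hfsupp, hgsupp]
    exact or_congr ⟨fun ⟨a, ⟨i, hi⟩, h⟩ => ⟨i, a, hi, h⟩, fun ⟨i, a, hi, h⟩ => ⟨a, ⟨i, hi⟩, h⟩⟩
      ⟨fun ⟨a, ⟨i, hi⟩, h⟩ => ⟨i, a, hi, h⟩, fun ⟨i, a, hi, h⟩ => ⟨a, ⟨i, hi⟩, h⟩⟩
  · exact Finset.mem_union_left _ (Finset.mem_image.2 ⟨0, hA0, Finsupp.mapDomain_zero⟩)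
  · have hinter : A.image (Finsupp.mapDomain (Sum.inl : σ → σ ⊕ τ)) ∩
        B.image (Finsupp.mapDomain Sum.inr) = {0} := by
      ext m
      simp only [Finset.mem_inter, Finset.mem_image, Finset.mem_singleton]
      constructor
      · rintro ⟨⟨a, -, rfl⟩, b, -, hb⟩
        ext (i | i)
        · rw [← hb, Finsupp.mapDomain_of_notMem_range _ _ (by simp)]
          rfl
        · rw [Finsupp.mapDomain_of_notMem_range _ _ (by simp)]
          rfl
      · rintro rfl
        exact ⟨⟨0, hA0, Finsupp.mapDomain_zero⟩, 0, hB0, Finsupp.mapDomain_zero⟩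
    have h := Finset.card_union_add_card_inter (A.image (Finsupp.mapDomain (Sum.inl : σ → σ ⊕ τ)))
      (B.image (Finsupp.mapDomain Sum.inr))
    rw [hinter, Finset.card_singleton,
      Finset.card_image_of_injective _ (Finsupp.mapDomain_injective Sum.inl_injective),
      Finset.card_image_of_injective _ (Finsupp.mapDomain_injective Sum.inr_injective),
      hAcard, hBcard] at h
    omega
  · rw [Finset.card_map, Finset.card_product]
    exact Nat.mul_le_mul hS hT
  · intro z hz
    obtain ⟨⟨x, y⟩, hxy, rfl⟩ := Finset.mem_map.1 hz
    obtain ⟨hx, hy⟩ := Finset.mem_product.1 hxy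
    obtain ⟨hfpos, hfzero, hfnd⟩ := hf x hx
    obtain ⟨hgpos, hgzero, hgnd⟩ := hg y hy
    change IsNondegeneratePositiveZero _ (Sum.elim x y)
    refine ⟨?_, ?_, fun v hv => ?_⟩
    · rintro (i | i)
      exacts [hfpos i, hgpos i]
    · rintro (i | i)
      · simpa [eval_rename] using hfzero i
      · simpa [eval_rename] using hgzero i
    · have h1 := hfnd (v ∘ Sum.inl) fun i => by
        simpa [directionalDeriv_rename] using hv (Sum.inl i)
      have h2 := hgnd (v ∘ Sum.inr) fun i => by
        simpa [directionalDeriv_rename] using hv (Sum.inr i)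
      ext (i | i)
      exacts [congrFun h1 i, congrFun h2 i]

end DirectionalDerivative

section Chain

open MvPolynomial

/-- The `j`-th variable, or `1` when `j` is out of range. -/
noncomputable def chainVar (n j : ℕ) : MvPolynomial (Fin n) ℝ :=
  if h : j < n then X ⟨j, h⟩ else 1

/-- The exponent of `chainVar n j`. -/
noncomputable def chainExp (n j : ℕ) : Fin n →₀ ℕ :=
  if h : j < n then Finsupp.single ⟨j, h⟩ 1 else 0

/-- The system `X j * X (j + 1) = 1 + c j * X 0 ^ 2`. -/
noncomputable def chainSystem (c : ℕ → ℝ) (n : ℕ) (j : Fin n) : MvPolynomial (Fin n) ℝ :=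
  chainVar n j * chainVar n (j + 1) - 1 - C (c j) * (chainVar n 0 * chainVar n 0)

theorem chainVar_eq_monomial (n j : ℕ) : chainVar n j = monomial (chainExp n j) 1 := by
  unfold chainVar chainExp
  split_ifs <;> rfl

theorem chainExp_apply (n j : ℕ) (i : Fin n) :
    chainExp n j i = if (i : ℕ) = j then 1 else 0 := by
  unfold chainExp
  split_ifs with h1 h2 h2
  · subst h2
    simp
  · rw [Finsupp.single_eq_of_ne]
    rintro rfl
    exact h2 rfl
  · omega
  · rfl

theorem mem_support_chainSystem {c : ℕ → ℝ} (hc : ∀ i, 0 < c i) {n : ℕ} (j : Fin n)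
    (m : Fin n →₀ ℕ) : m ∈ (chainSystem c n j).support ↔
      m = chainExp n j + chainExp n (j + 1) ∨ m = 0 ∨ m = chainExp n 0 + chainExp n 0 := by
  have hn : 0 < n := j.pos
  have h1 : chainExp n j + chainExp n (j + 1) ≠ 0 := fun h => by
    simpa [chainExp_apply] using DFunLike.congr_fun h j
  have h2 : chainExp n j + chainExp n (j + 1) ≠ chainExp n 0 + chainExp n 0 := fun h => by
    have := DFunLike.congr_fun h j
    simp only [Finsupp.add_apply, chainExp_apply] at this
    split_ifs at this <;> omega
  have h3 : chainExp n 0 + chainExp n 0 ≠ 0 := fun h => by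
    simpa [chainExp_apply] using DFunLike.congr_fun h ⟨0, hn⟩
  have hcoeff : coeff m (chainSystem c n j) =
      (if chainExp n j + chainExp n (j + 1) = m then 1 else 0) - (if 0 = m then 1 else 0) -
        (if chainExp n 0 + chainExp n 0 = m then c j else 0) := by
    simp [chainSystem, chainVar_eq_monomial, monomial_mul, coeff_monomial, coeff_one,
      coeff_C_mul]
  have hcj := (hc j).ne'
  rw [mem_support_iff, hcoeff]
  constructor
  · intro h
    by_contra! hm
    exact h (by simp [hm.1.symm, hm.2.1.symm, hm.2.2.symm])
  · rintro (rfl | rfl | rfl)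
    · simp [h1.symm, h2.symm]
    · simp [h1, h3]
    · simp [h2, h3.symm, hcj]

theorem chainSystem_support {c : ℕ → ℝ} (hc : ∀ i, 0 < c i) {n : ℕ} (hn : 0 < n) :
    ∃ A : Finset (Fin n →₀ ℕ), (∀ m, m ∈ A ↔ ∃ i, m ∈ (chainSystem c n i).support) ∧
      0 ∈ A ∧ A.card = n + 1 + 1 := by
  classical
  have hinj : Function.Injective fun j : Fin n => chainExp n j + chainExp n (j + 1) := by
    intro i j hij
    have h1 := DFunLike.congr_fun hij i
    have h2 := DFunLike.congr_fun hij j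
    simp only [Finsupp.add_apply, chainExp_apply] at h1 h2
    apply Fin.ext
    split_ifs at h1 h2 <;> omega
  refine ⟨insert 0 (insert (chainExp n 0 + chainExp n 0) (Finset.univ.image fun j : Fin n =>
    chainExp n j + chainExp n (j + 1))), fun m => ?_, Finset.mem_insert_self _ _, ?_⟩
  · simp only [mem_support_chainSystem hc, Finset.mem_insert, Finset.mem_image, Finset.mem_univ,
      true_and]
    constructor
    · rintro (h | h | ⟨j, h⟩)
      exacts [⟨⟨0, hn⟩, .inr (.inl h)⟩, ⟨⟨0, hn⟩, .inr (.inr h)⟩, ⟨j, .inl h.symm⟩]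
    · rintro ⟨j, h | h | h⟩
      exacts [.inr (.inr ⟨j, h.symm⟩), .inl h, .inr (.inl h)]
  · rw [Finset.card_insert_of_notMem, Finset.card_insert_of_notMem,
      Finset.card_image_of_injective _ hinj, Finset.card_univ, Fintype.card_fin]
    · rw [Finset.mem_image]
      rintro ⟨j, -, h⟩
      have := DFunLike.congr_fun h j
      simp only [Finsupp.add_apply, chainExp_apply] at this
      split_ifs at this <;> omega
    · rw [Finset.mem_insert, Finset.mem_image]
      rintro (h | ⟨j, -, h⟩)
      · simpa [chainExp_apply] using DFunLike.congr_fun h ⟨0, hn⟩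
      · simpa [chainExp_apply] using DFunLike.congr_fun h j

/-- The sequence `x` with `x 0 = s` and `x j * x (j + 1) = 1 + c j * s ^ 2`. -/
noncomputable def chainPoint (c : ℕ → ℝ) (s : ℝ) : ℕ → ℝ
  | 0 => s
  | j + 1 => (1 + c j * s ^ 2) / chainPoint c s j

theorem chainPoint_pos {c : ℕ → ℝ} (hc : ∀ i, 0 < c i) {s : ℝ} (hs : 0 < s) (j : ℕ) :
    0 < chainPoint c s j := by
  induction j with
  | zero => exact hs
  | succ j ih =>
    have := hc j
    rw [chainPoint]
    positivity

theorem chainPoint_mul {c : ℕ → ℝ} (hc : ∀ i, 0 < c i) {s : ℝ} (hs : 0 < s) (j : ℕ) :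
    chainPoint c s j * chainPoint c s (j + 1) = 1 + c j * chainPoint c s 0 ^ 2 := by
  simp only [chainPoint]
  exact mul_div_cancel₀ _ (chainPoint_pos hc hs j).ne'

theorem chainPoint_eq_one {c : ℕ → ℝ} (hc : ∀ i, 0 < c i) {s : ℝ} (hs : 0 < s) {n : ℕ}
    (hroot : (eliminant c n).eval (s ^ 2) = 0) : chainPoint c s n = 1 := by
  have h := alternatingPair_eval_of_chain (n := n) fun j _ => chainPoint_mul hc hs j
  have hU := (alternatingPair_eval_pos hc (pow_pos hs 2) n).1
  rw [eliminant, Polynomial.eval_sub, sub_eq_zero] at hroot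
  change _ = Polynomial.eval (s ^ 2) _ * _ at h
  change Polynomial.eval (s ^ 2) _ = _ at h
  rw [hroot] at h
  have h1 : chainPoint c s n ^ 2 = 1 := by
    apply mul_left_cancel₀ hU.ne'
    rw [← h, mul_one]
  exact (pow_eq_one_iff_of_nonneg (chainPoint_pos hc hs n).le two_ne_zero).1 h1

theorem chainPoint_isNondegeneratePositiveZero {c : ℕ → ℝ} (hc : ∀ i, 0 < c i) {s : ℝ}
    (hs : 0 < s) {n : ℕ} (hroot : (eliminant c n).eval (s ^ 2) = 0)
    (hsimple : (eliminant c n).derivative.eval (s ^ 2) ≠ 0) :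
    IsNondegeneratePositiveZero (chainSystem c n) fun j => chainPoint c s j := by
  have hone := chainPoint_eq_one hc hs hroot
  have hmul := chainPoint_mul hc hs
  have hpos := chainPoint_pos hc hs
  have heval : ∀ j ≤ n, eval (fun i : Fin n => chainPoint c s i) (chainVar n j) =
      chainPoint c s j := by
    intro j hj
    unfold chainVar
    split_ifs with h
    · simp
    · rw [show j = n by omega, hone, map_one]
  refine ⟨fun j => hpos j, fun j => ?_, fun v hv => ?_⟩
  · simp only [chainSystem, map_sub, map_mul, map_one, eval_C]
    rw [heval _ j.2.le, heval _ j.2, heval _ (Nat.zero_le n), hmul]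
    ring
  · let w : ℕ → ℝ := fun j => if h : j < n then v ⟨j, h⟩ else 0
    have hdir (j : ℕ) : directionalDeriv (fun i : Fin n => chainPoint c s i) v (chainVar n j) =
        w j := by
      simp only [chainVar, w]
      split_ifs
      · exact directionalDeriv_X _ _ _
      · exact directionalDeriv_one _ _
    have hlin : ∀ j < n, w j * chainPoint c s (j + 1) + chainPoint c s j * w (j + 1) =
        c j * (2 * chainPoint c s 0 * w 0) := by
      intro j hj
      have h := hv ⟨j, hj⟩
      simp only [chainSystem, directionalDeriv_sub, directionalDeriv_mul, directionalDeriv_one,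
        directionalDeriv_C, hdir, eval_C] at h
      rw [heval _ hj.le, heval _ hj, heval _ (Nat.zero_le n)] at h
      linear_combination h
    have hwn : w n = 0 := by simp [w]
    have hder := alternatingPair_derivative_of_chain (n := n) (fun j _ => hmul j) hlin
    rw [hone, hwn] at hder
    have hw0 : w 0 = 0 := by
      rw [eliminant, Polynomial.derivative_sub, Polynomial.eval_sub] at hsimple
      have h2 : (2 * s) ≠ 0 := by positivity
      apply mul_left_cancel₀ (mul_ne_zero hsimple h2)
      simp only [chainPoint] at hder
      linear_combination hder
    have hw : ∀ j ≤ n, w j = 0 := by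
      intro j
      induction j with
      | zero => exact fun _ => hw0
      | succ j ih =>
        intro hj
        have h := hlin j hj
        rw [ih (by omega), hw0] at h
        apply mul_left_cancel₀ (hpos j).ne'
        linear_combination h
    ext j
    simpa [w] using hw j j.2.le

/-- A system in `n` variables with `n + 2` monomials and `n + 1` nondegenerate positive zeros. -/
theorem hasFewnomialSystem_chain {n : ℕ} (hn : 0 < n) :
    HasFewnomialSystem (Fin n) (n + 1) (n + 1) := by
  classical
  obtain ⟨c, hc, R, hR, hroots⟩ := exists_eliminant_simple_roots n
  refine ⟨chainSystem c n, chainSystem_support hc hn,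
    R.image fun t => fun j : Fin n => chainPoint c (Real.sqrt t) j, ?_, ?_⟩
  · rw [Finset.card_image_of_injOn, hR]
    intro t ht u hu htu
    exact (Real.sqrt_inj (hroots t ht).1.le (hroots u hu).1.le).1 (congrFun htu ⟨0, hn⟩)
  · intro x hx
    obtain ⟨t, ht, rfl⟩ := Finset.mem_image.1 hx
    obtain ⟨hpos, hzero, hder⟩ := hroots t ht
    have hsq := Real.sq_sqrt hpos.le
    exact chainPoint_isNondegeneratePositiveZero hc (Real.sqrt_pos.2 hpos)
      (by rwa [hsq]) (by rwa [hsq])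

/-- Juxtaposing `k` chains, all but one of them in `q` variables. -/
theorem hasFewnomialSystem_of_mul_le {q : ℕ} (hq : 0 < q) (k n : ℕ) (h : (k + 1) * q ≤ n) :
    HasFewnomialSystem (Fin n) (n + (k + 1)) ((q + 1) ^ (k + 1)) := by
  induction k generalizing n with
  | zero =>
    rw [zero_add, one_mul] at h
    exact (hasFewnomialSystem_chain (hq.trans_le h)).mono (by simpa using h)
  | succ k ih =>
    rw [add_mul, one_mul] at h
    have hsum := (ih (n - q) (by omega)).sum (hasFewnomialSystem_chain hq)
    have hn : n - q + q = n := by omega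
    have := hsum.congr (finSumFinEquiv.trans (finCongr hn))
    rwa [show n - q + (k + 1) + (q + 1) = n + (k + 1 + 1) by omega, ← pow_succ] at this

end Chain


/-- For all positive integers `n` and `k` with `n > k`, there exists a
system of `n` polynomials in `n` real variables whose union of supports consists of exactly
`n + k + 1` distinct exponent vectors, having at least `⌊(n+k)/k⌋ ^ k` distinct points in
the positive orthant that are nondegenerate solutions of the system. -/
theorem fewnomial_lower_bound (n k : ℕ) (hk : 0 < k) (hkn : k < n) :
    ∃ f : Fin n → MvPolynomial (Fin n) ℝ,
      (Finset.univ.biUnion fun i => (f i).support).card = n + k + 1 ∧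
      ∃ S : Finset (Fin n → ℝ),
        ((n + k) / k) ^ k ≤ S.card ∧
        ∀ x ∈ S,
          (∀ i, 0 < x i) ∧
          (∀ i, MvPolynomial.eval x (f i) = 0) ∧
          (Matrix.of fun i j => MvPolynomial.eval x (MvPolynomial.pderiv j (f i))).det ≠ 0 := by
  have hle : (k - 1 + 1) * (n / k) ≤ n := by
    rw [Nat.sub_add_cancel hk]
    exact Nat.mul_div_le n k
  obtain ⟨f, ⟨A, hA, -, hcard⟩, S, hS, hf⟩ :=
    hasFewnomialSystem_of_mul_le (Nat.div_pos hkn.le hk) (k - 1) n hle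
  rw [Nat.sub_add_cancel hk] at hcard hS
  refine ⟨f, ?_, S, by rwa [Nat.add_div_right n hk], fun x hx => ?_⟩
  · rw [← hcard]
    congr 1
    ext m
    simp [hA]
  · obtain ⟨hpos, hzero, hnd⟩ := hf x hx
    refine ⟨hpos, hzero, fun hdet => ?_⟩
    obtain ⟨v, hv, hmul⟩ := Matrix.exists_mulVec_eq_zero_iff.2 hdet
    exact hv (hnd v fun i => congrFun hmul i)
end

section
/- Let m and k be positive integers. Suppose f_1, ..., f_m are polynomials in m real variables y_1, ..., y_m, all supported on the same set of m+2 exponent vectors, one of which is the zero vector (a constant term), and suppose the system f_1 = ... = f_m = 0 has m+1 nondegenerate solutions in the positive orthant ℝ^m_>. For j = 1, ..., k introduce disjoint sets of variables y_{j,1}, ..., y_{j,m} and consider the combined system of km equations f_i(y_{j,1}, ..., y_{j,m}) = 0 for 1 ≤ i ≤ m, 1 ≤ j ≤ k, in the km variables. Then this combined system involves exactly 1 + k(m+1) = km + k + 1 distinct monomials and has exactly (m+1)^k nondegenerate solutions in the positive orthant ℝ^{km}_>. -/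
open Finset in
/-- Padding by zeros sends a set of `a + 1` exponent vectors containing zero to `k` sets, one per
block of variables, whose union has `1 + k * a` elements. -/
theorem card_biUnion_mapDomain_block {m k : ℕ} (hk : 0 < k) (A : Finset (Fin m →₀ ℕ))
    (h0A : (0 : Fin m →₀ ℕ) ∈ A) :
    (univ.biUnion fun j : Fin k => A.image (Finsupp.mapDomain fun l => (j, l))).card =
      k * (A.card - 1) + 1 := by
  have hinj (j : Fin k) : Function.Injective fun l : Fin m => (j, l) := Prod.mk_right_injective j
  let φ : Fin k × (Fin m →₀ ℕ) → (Fin k × Fin m →₀ ℕ) :=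
    fun x => Finsupp.mapDomain (fun l => (x.1, l)) x.2
  have hφ : Set.InjOn φ (univ ×ˢ A.erase 0 : Finset (Fin k × (Fin m →₀ ℕ))) := by
    rintro ⟨i, a⟩ ha ⟨j, b⟩ - h
    obtain rfl | hij := eq_or_ne i j
    · exact Prod.ext rfl (Finsupp.mapDomain_injective (hinj i) h)
    · refine absurd (Finsupp.ext fun l => ?_)
        (mem_erase.1 (mem_product.1 ha).2).1
      have hl := DFunLike.congr_fun h (i, l)
      simp only [φ] at hl
      rw [Finsupp.mapDomain_apply (hinj i), Finsupp.mapDomain_of_notMem_range] at hl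
      · simpa using hl
      · rintro ⟨l', hl'⟩
        exact hij (congrArg Prod.fst hl').symm
  have hunion : (univ.biUnion fun j : Fin k => A.image (Finsupp.mapDomain fun l => (j, l))) =
      insert 0 ((univ ×ˢ A.erase 0).image φ) := by
    ext x
    simp only [mem_biUnion, mem_univ, true_and, mem_image, mem_insert, mem_product, mem_erase,
      Prod.exists, φ]
    constructor
    · rintro ⟨j, a, ha, rfl⟩
      obtain rfl | h := eq_or_ne a 0
      · simp
      · exact .inr ⟨j, a, ⟨h, ha⟩, rfl⟩
    · rintro (rfl | ⟨j, a, ⟨-, ha⟩, rfl⟩)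
      · exact ⟨⟨0, hk⟩, 0, h0A, Finsupp.mapDomain_zero⟩
      · exact ⟨j, a, ha, rfl⟩
  rw [hunion, card_insert_of_notMem, card_image_of_injOn hφ, card_product, card_erase_of_mem h0A,
    card_univ, Fintype.card_fin]
  simp only [mem_image, mem_product, mem_univ, true_and, mem_erase, Prod.exists, φ, not_exists,
    not_and]
  rintro j a ⟨h, -⟩ h'
  exact h (Finsupp.mapDomain_injective (hinj j) (h'.trans Finsupp.mapDomain_zero.symm))

/-- The Jacobian determinant of copies of a system in disjoint blocks of variables is the product
of the Jacobian determinants of the copies. -/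
theorem det_jacobian_rename_block {R ι κ : Type*} [CommRing R] [Fintype ι] [DecidableEq ι]
    [Fintype κ] [DecidableEq κ] (f : ι → MvPolynomial ι R) (x : κ × ι → R) :
    (Matrix.of fun p q : κ × ι => MvPolynomial.eval x (MvPolynomial.pderiv q
      (MvPolynomial.rename (fun l => (p.1, l)) (f p.2)))).det =
    ∏ j, (Matrix.of fun i l => MvPolynomial.eval (fun l => x (j, l))
      (MvPolynomial.pderiv l (f i))).det := by
  rw [← Matrix.det_blockDiagonal, ← Matrix.det_submatrix_equiv_self (Equiv.prodComm κ ι)]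
  congr 1
  ext ⟨j, i⟩ ⟨j', l⟩
  simp only [Matrix.of_apply, Matrix.submatrix_apply, Equiv.prodComm_apply, Prod.swap_prod_mk,
    Matrix.blockDiagonal_apply]
  split_ifs with h
  · subst h
    rw [MvPolynomial.pderiv_rename (Prod.mk_right_injective j), MvPolynomial.eval_rename]
    rfl
  · rw [MvPolynomial.pderiv_eq_zero_of_notMem_vars, map_zero]
    intro hmem
    obtain ⟨l', -, hl'⟩ := Finset.mem_image.1 (MvPolynomial.vars_rename _ _ hmem)
    exact h (congrArg Prod.fst hl')

/-- If `f 1, …, f m` are polynomials in `m` variables, all supported on the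
same set of `m + 2` exponent vectors, one of which is the zero vector, and the system has
exactly `m + 1` nondegenerate positive solutions, then the combined system obtained by
taking `k` copies of the system in `k` disjoint blocks of variables involves exactly
`k * m + k + 1 = 1 + k * (m + 1)` distinct monomials and has exactly `(m+1)^k`
nondegenerate solutions in the positive orthant. -/
theorem combined_system_count (m k : ℕ) (hm : 0 < m) (hk : 0 < k)
    (f : Fin m → MvPolynomial (Fin m) ℝ) (A : Finset (Fin m →₀ ℕ))
    (hA : A.card = m + 2) (h0A : (0 : Fin m →₀ ℕ) ∈ A)
    (hsupp : ∀ i, (f i).support = A)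
    (T : Finset (Fin m → ℝ))
    (hT : ∀ y : Fin m → ℝ, y ∈ T ↔
      ((∀ i, 0 < y i) ∧ (∀ i, MvPolynomial.eval y (f i) = 0) ∧
        (Matrix.of fun i j => MvPolynomial.eval y (MvPolynomial.pderiv j (f i))).det ≠ 0))
    (hTcard : T.card = m + 1)
    (g : Fin k × Fin m → MvPolynomial (Fin k × Fin m) ℝ)
    (hg : ∀ p : Fin k × Fin m,
      g p = MvPolynomial.rename (fun l => (p.1, l)) (f p.2)) :
    (Finset.univ.biUnion fun p => (g p).support).card = k * m + k + 1 ∧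
    ∃ S : Finset (Fin k × Fin m → ℝ),
      (∀ x : Fin k × Fin m → ℝ, x ∈ S ↔
        ((∀ v, 0 < x v) ∧ (∀ p, MvPolynomial.eval x (g p) = 0) ∧
          (Matrix.of fun p q => MvPolynomial.eval x (MvPolynomial.pderiv q (g p))).det ≠ 0)) ∧
      S.card = (m + 1) ^ k := by
  obtain rfl : g = fun p => MvPolynomial.rename (fun l => (p.1, l)) (f p.2) := funext hg
  constructor
  · have hunion : (Finset.univ.biUnion fun p : Fin k × Fin m =>
        (MvPolynomial.rename (fun l => (p.1, l)) (f p.2)).support) =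
        Finset.univ.biUnion fun j : Fin k => A.image (Finsupp.mapDomain fun l => (j, l)) := by
      ext x
      simp only [MvPolynomial.support_rename_of_injective (Prod.mk_right_injective _), hsupp,
        Finset.mem_biUnion, Finset.mem_univ, true_and, Prod.exists]
      exact exists_congr fun j => ⟨fun ⟨_, h⟩ => h, fun h => ⟨⟨0, hm⟩, h⟩⟩
    rw [hunion, card_biUnion_mapDomain_block hk A h0A, hA]
    simp [mul_add]
  · refine ⟨(Fintype.piFinset fun _ : Fin k => T).map
      (Equiv.curry (Fin k) (Fin m) ℝ).symm.toEmbedding, fun x => ?_, ?_⟩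
    · simp only [Finset.mem_map_equiv, Equiv.symm_symm, Fintype.mem_piFinset, hT, forall_and,
        det_jacobian_rename_block, Finset.prod_ne_zero_iff, Finset.mem_univ, true_imp_iff,
        MvPolynomial.eval_rename, Prod.forall, Equiv.curry_apply]
      rfl
    · simp [hTcard]
end

section
/- The system of two polynomial equations in two variables x²y − (1 + 4x²) = 0 and xy − (4 + x²) = 0 has exactly 3 solutions in ℂ²; each of these solutions is nondegenerate (the Jacobian determinant of the system is nonzero there), and each solution has both coordinates real and strictly positive. -/
open MvPolynomial

/-- The system `x² y − (1 + 4x²) = x y − (4 + x²) = 0`. -/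
noncomputable def sysTwo : Fin 2 → MvPolynomial (Fin 2) ℂ :=
  ![(X 0) ^ 2 * X 1 - (1 + 4 * (X 0) ^ 2),
    X 0 * X 1 - (4 + (X 0) ^ 2)]

theorem eval_sysTwo_eq_zero_iff (x : Fin 2 → ℂ) :
    (∀ i, eval x (sysTwo i) = 0) ↔
      x 0 ^ 2 * x 1 - (1 + 4 * x 0 ^ 2) = 0 ∧ x 0 * x 1 - (4 + x 0 ^ 2) = 0 := by
  have h4 : eval x (4 : MvPolynomial (Fin 2) ℂ) = 4 := map_ofNat _ 4
  simp [Fin.forall_fin_two, sysTwo, h4]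

theorem det_jacobian_sysTwo (x : Fin 2 → ℂ) :
    (Matrix.of fun i j => eval x (pderiv j (sysTwo i))).det =
      x 0 ^ 2 * (x 1 - 8 + 2 * x 0) := by
  have h4 : eval x (4 : MvPolynomial (Fin 2) ℂ) = 4 := map_ofNat _ 4
  have hd (i : Fin 2) : pderiv i (4 : MvPolynomial (Fin 2) ℂ) = 0 :=
    (pderiv i).map_natCast 4
  simp [Matrix.det_fin_two, sysTwo, h4, hd, pderiv_X]
  ring

/-- The solution of the system whose first coordinate is the root `(3 + a) / 2` of
`x² - 3x + 1`, where `a² = 5`. -/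
noncomputable def sysTwoPoint (a : ℝ) : Fin 2 → ℂ :=
  ![((3 + a) / 2 : ℝ), ((15 - 3 * a) / 2 : ℝ)]

theorem sysTwo_eq_zero_iff {a : ℝ} (ha : a ^ 2 = 5) (x : Fin 2 → ℂ) :
    (∀ i, eval x (sysTwo i) = 0) ↔
      x = ![1, 5] ∨ x = sysTwoPoint a ∨ x = sysTwoPoint (-a) := by
  have hc : (a : ℂ) ^ 2 = 5 := by exact_mod_cast ha
  rw [eval_sysTwo_eq_zero_iff]
  constructor
  · rintro ⟨h1, h2⟩
    have hx : (x 0 - 1) * ((x 0 - (3 + a) / 2) * (x 0 - (3 - a) / 2)) = 0 := by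
      linear_combination h1 - x 0 * h2 - (x 0 - 1) / 4 * hc
    have hx0 : x 0 ≠ 0 := by
      intro h
      simp [h] at h2
    rcases mul_eq_zero.1 hx with h | h
    · left
      have h0 : x 0 = 1 := sub_eq_zero.1 h
      rw [h0] at h2
      ext i
      fin_cases i
      · exact h0
      · simp
        linear_combination h2
    · right
      refine (mul_eq_zero.1 h).imp (fun h => ?_) (fun h => ?_)
      all_goals
        have h0 := sub_eq_zero.1 h
        ext i
        fin_cases i
        · simp [sysTwoPoint, h0, sub_eq_add_neg]
        · apply mul_left_cancel₀ hx0
          simp only [sysTwoPoint, Fin.mk_one, Matrix.cons_val_one]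
          push_cast
          rw [h0] at h2 ⊢
          linear_combination h2 + hc
  · rintro (rfl | rfl | rfl)
    · norm_num
    · simp only [sysTwoPoint, Matrix.cons_val_zero, Matrix.cons_val_one]
      push_cast
      constructor
      · linear_combination (-3 * (a : ℂ) - 11) / 8 * hc
      · linear_combination -hc
    · simp only [sysTwoPoint, Matrix.cons_val_zero, Matrix.cons_val_one]
      push_cast
      constructor
      · linear_combination (3 * (a : ℂ) - 11) / 8 * hc
      · linear_combination -hc

theorem sysTwoPoint_nondegenerate_and_pos {a : ℝ} (ha : a ^ 2 = 5) :
    (Matrix.of fun i j =>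
      eval (sysTwoPoint a) (pderiv j (sysTwo i))).det ≠ 0 ∧
      ∀ i, (sysTwoPoint a i).im = 0 ∧ 0 < (sysTwoPoint a i).re := by
  have h1 : -3 < a := by nlinarith
  have h2 : a < 3 := by nlinarith
  constructor
  · rw [det_jacobian_sysTwo]
    simp only [sysTwoPoint, Matrix.cons_val_zero, Matrix.cons_val_one]
    norm_cast
    exact mul_ne_zero (pow_ne_zero _ (by linarith)) (by linarith)
  · simp only [Fin.forall_fin_two, sysTwoPoint, Matrix.cons_val_zero, Matrix.cons_val_one,
      Complex.ofReal_im, Complex.ofReal_re, true_and]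
    constructor <;> linarith

/-- The system `x²y − (1 + 4x²) = 0`, `xy − (4 + x²) = 0` has exactly `3`
solutions in `ℂ²`; each solution is nondegenerate (the Jacobian determinant is nonzero
there) and has both coordinates real and strictly positive. -/
theorem sysTwo_count :
    ∃ S : Finset (Fin 2 → ℂ),
      (∀ x : Fin 2 → ℂ, x ∈ S ↔ ∀ i, MvPolynomial.eval x (sysTwo i) = 0) ∧
      S.card = 3 ∧
      ∀ x ∈ S,
        (Matrix.of fun i j => MvPolynomial.eval x (MvPolynomial.pderiv j (sysTwo i))).det ≠ 0 ∧
        ∀ i, (x i).im = 0 ∧ 0 < (x i).re := by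
  classical
  have ha : √5 ^ 2 = (5 : ℝ) := Real.sq_sqrt (by norm_num)
  have hpos : 0 < √(5 : ℝ) := by positivity
  have hne {a : ℝ} (ha : a ^ 2 = 5) : ![1, 5] ≠ sysTwoPoint a := by
    intro h
    have h0 := congrArg Complex.re (congrFun h 0)
    simp [sysTwoPoint] at h0
    nlinarith
  have hne' : sysTwoPoint √5 ≠ sysTwoPoint (-√5) := by
    intro h
    have h0 := congrArg Complex.re (congrFun h 0)
    simp only [sysTwoPoint, Matrix.cons_val_zero, Complex.ofReal_re] at h0
    linarith
  have ha' : (-√5) ^ 2 = (5 : ℝ) := by rw [neg_sq, ha]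
  refine ⟨{![1, 5], sysTwoPoint √5, sysTwoPoint (-√5)}, fun x => ?_, ?_, fun x hx => ?_⟩
  · simp only [Finset.mem_insert, Finset.mem_singleton, sysTwo_eq_zero_iff ha]
  · exact Finset.card_eq_three.2 ⟨_, _, _, hne ha, hne ha', hne', rfl⟩
  · simp only [Finset.mem_insert, Finset.mem_singleton] at hx
    rcases hx with rfl | rfl | rfl
    · rw [det_jacobian_sysTwo]
      norm_num [Fin.forall_fin_two]
    · exact sysTwoPoint_nondegenerate_and_pos ha
    · exact sysTwoPoint_nondegenerate_and_pos ha'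
end
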